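/- arXiv:2101.03977 — 2 statements merged into one kernel-verified Lean document; each statement's English description precedes it below -/
import Mathlib

section
/- Let μ_j (j ∈ ℕ) and μ be nonnegative locally finite Borel measures on ℝ^n whose Gauss–Weierstrass integrals Wμ_j and Wμ are finite on ℝ^n × (0,∞). If Wμ_j → Wμ uniformly on compact subsets of ℝ^n × (0,∞), then μ_j → μ in the weak-* sense: ∫ ψ dμ_j → ∫ ψ dμ for every ψ ∈ C_c(ℝ^n). -/
open MeasureTheory Filter

/-- The Gauss–Weierstrass (heat) kernel on ℝⁿ. -/
noncomputable def W (n : ℕ) (x : EuclideanSpace ℝ (Fin n)) (t : ℝ) : ℝ :=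
  (4 * Real.pi * t) ^ (-(n : ℝ) / 2) * Real.exp (-‖x‖ ^ 2 / (4 * t))

open Topology in
/-- Continuous functions vanishing at infinity, extended by `0` to the one-point
compactification. -/
noncomputable def extZero {n : ℕ} (f : EuclideanSpace ℝ (Fin n) → ℝ) (hf : Continuous f)
    (h : Tendsto f (cocompact _) (𝓝 0)) : C(OnePoint (EuclideanSpace ℝ (Fin n)), ℝ) :=
  OnePoint.continuousMapMk ⟨f, hf⟩ 0 (by rw [coclosedCompact_eq_cocompact]; exact h)

/-- The monoid of functions on the one-point compactification that are Gaussian-like. -/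
noncomputable def gaussMonoid (n : ℕ) :
    Submonoid C(OnePoint (EuclideanSpace ℝ (Fin n)), ℝ) where
  carrier := {F | ∃ a : ℝ, 0 ≤ a ∧ ∃ (b : EuclideanSpace ℝ (Fin n)) (c : ℝ),
    ∀ x : EuclideanSpace ℝ (Fin n),
      F (x : OnePoint (EuclideanSpace ℝ (Fin n)))
        = Real.exp (-a * ‖x‖ ^ 2 + inner ℝ b x + c)}
  one_mem' := ⟨0, le_refl _, 0, 0, fun x => by simp⟩
  mul_mem' := by
    rintro F H ⟨a, ha, b, c, hF⟩ ⟨a', ha', b', c', hH⟩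
    refine ⟨a + a', add_nonneg ha ha', b + b', c + c', fun x => ?_⟩
    rw [ContinuousMap.mul_apply, hF, hH, ← Real.exp_add, inner_add_left]
    congr 1
    ring

theorem gauss_tendsto {n : ℕ} (z : EuclideanSpace ℝ (Fin n)) :
    Tendsto (fun x : EuclideanSpace ℝ (Fin n) => Real.exp (-‖x - z‖ ^ 2))
      (cocompact _) (nhds 0) := by
  have h1 : Tendsto (fun x : EuclideanSpace ℝ (Fin n) => ‖x - z‖) (cocompact _) atTop :=
    tendsto_norm_cocompact_atTop.comp (Homeomorph.subRight z).isClosedEmbedding.tendsto_cocompact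
  have h2 := (tendsto_pow_atTop (α := ℝ) two_ne_zero).comp h1
  exact Real.tendsto_exp_neg_atTop_nhds_zero.comp h2

/-- A Gaussian extended to the one-point compactification. -/
noncomputable def gaussExt {n : ℕ} (z : EuclideanSpace ℝ (Fin n)) :
    C(OnePoint (EuclideanSpace ℝ (Fin n)), ℝ) :=
  extZero (fun x => Real.exp (-‖x - z‖ ^ 2)) (by fun_prop) (gauss_tendsto z)

theorem gaussExt_coe {n : ℕ} (z x : EuclideanSpace ℝ (Fin n)) :
    gaussExt z (x : OnePoint (EuclideanSpace ℝ (Fin n))) = Real.exp (-‖x - z‖ ^ 2) := rfl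

theorem gaussExt_infty {n : ℕ} (z : EuclideanSpace ℝ (Fin n)) :
    gaussExt z OnePoint.infty = 0 := rfl

theorem gaussExt_mem {n : ℕ} (z : EuclideanSpace ℝ (Fin n)) : gaussExt z ∈ gaussMonoid n := by
  refine ⟨1, zero_le_one, (2 : ℝ) • z, -‖z‖ ^ 2, fun x => ?_⟩
  rw [gaussExt_coe, @norm_sub_sq_real, inner_smul_left, real_inner_comm]
  congr 1
  simp
  ring

theorem gauss_dense (n : ℕ) (f : C(OnePoint (EuclideanSpace ℝ (Fin n)), ℝ)) (ε : ℝ)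
    (hε : 0 < ε) :
    ∃ h ∈ Submodule.span ℝ (gaussMonoid n : Set C(OnePoint (EuclideanSpace ℝ (Fin n)), ℝ)),
      ‖h - f‖ < ε := by
  have hs : (Algebra.adjoin ℝ
      (gaussMonoid n : Set C(OnePoint (EuclideanSpace ℝ (Fin n)), ℝ))).SeparatesPoints := by
    intro x y hxy
    have key : ∀ z, gaussExt z x ≠ gaussExt z y →
        ∃ f ∈ (fun f : C(OnePoint (EuclideanSpace ℝ (Fin n)), ℝ) => (f : _ → ℝ)) ''
          ((Algebra.adjoin ℝ
      (gaussMonoid n : Set C(OnePoint (EuclideanSpace ℝ (Fin n)), ℝ)) : Subalgebra ℝ _) :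
        Set C(OnePoint (EuclideanSpace ℝ (Fin n)), ℝ)), f x ≠ f y := fun z hz =>
      ⟨_, ⟨gaussExt z, Algebra.subset_adjoin (gaussExt_mem z), rfl⟩, hz⟩
    induction x using OnePoint.rec with
    | infty =>
      induction y using OnePoint.rec with
      | infty => exact absurd rfl hxy
      | coe y =>
        refine key y ?_
        rw [gaussExt_coe, gaussExt_infty]
        exact (Real.exp_pos _).ne
    | coe x =>
      refine key x ?_
      induction y using OnePoint.rec with
      | infty =>
        rw [gaussExt_coe, gaussExt_infty]
        exact (Real.exp_pos _).ne'
      | coe y =>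
        rw [gaussExt_coe, gaussExt_coe]
        have hne : y - x ≠ 0 := sub_ne_zero.2 fun h => hxy (by rw [h])
        have := norm_pos_iff.2 hne
        intro h
        have h' := Real.exp_injective h
        simp at h'
        exact hne h'
  obtain ⟨⟨h, hh⟩, hlt⟩ :=
    ContinuousMap.exists_mem_subalgebra_near_continuousMap_of_separatesPoints _ hs f ε hε
  refine ⟨h, ?_, hlt⟩
  rw [← Subalgebra.mem_toSubmodule, Algebra.adjoin_eq_span, Submonoid.closure_eq] at hh
  exact hh

/-- Every function `exp (-a|x|² + b·x + c)` with `a > 0` is a multiple of a heat kernel. -/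
theorem exp_eq_W {n : ℕ} (a : ℝ) (ha : 0 < a) (b : EuclideanSpace ℝ (Fin n)) (c : ℝ) :
    ∃ (C t : ℝ) (z : EuclideanSpace ℝ (Fin n)), 0 < t ∧
      (fun x : EuclideanSpace ℝ (Fin n) => Real.exp (-a * ‖x‖ ^ 2 + inner ℝ b x + c))
        = fun x => C * W n (z - x) t := by
  set z : EuclideanSpace ℝ (Fin n) := (1 / (2 * a)) • b with hz
  have ht : 0 < 1 / (4 * a) := by positivity
  set K : ℝ := (4 * Real.pi * (1 / (4 * a))) ^ (-(n : ℝ) / 2) with hK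
  have hKpos : 0 < K := Real.rpow_pos_of_pos (by positivity) _
  refine ⟨K⁻¹ * Real.exp (a * ‖z‖ ^ 2 + c), 1 / (4 * a), z, ht, ?_⟩
  funext x
  unfold W
  rw [← hK]
  have e : Real.exp (-a * ‖x‖ ^ 2 + inner ℝ b x + c)
      = Real.exp (a * ‖z‖ ^ 2 + c) * Real.exp (-‖z - x‖ ^ 2 / (4 * (1 / (4 * a)))) := by
    rw [← Real.exp_add, @norm_sub_sq_real]
    congr 1
    have : inner ℝ z x = 1 / (2 * a) * inner ℝ b x := by
      rw [hz, inner_smul_left]; simp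
    rw [this]
    field_simp
    ring
  rw [e]
  field_simp

theorem stmt14 {n : ℕ} (μ : ℕ → Measure (EuclideanSpace ℝ (Fin n)))
    (ν : Measure (EuclideanSpace ℝ (Fin n)))
    [∀ j, IsLocallyFiniteMeasure (μ j)] [IsLocallyFiniteMeasure ν]
    (hμ : ∀ j (x : EuclideanSpace ℝ (Fin n)) (t : ℝ), 0 < t →
      Integrable (fun ξ => W n (x - ξ) t) (μ j))
    (hν : ∀ (x : EuclideanSpace ℝ (Fin n)) (t : ℝ), 0 < t →
      Integrable (fun ξ => W n (x - ξ) t) ν)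
    (hconv : ∀ K : Set (EuclideanSpace ℝ (Fin n) × ℝ), IsCompact K →
      K ⊆ Set.univ ×ˢ Set.Ioi (0 : ℝ) →
      TendstoUniformlyOn (fun j p => ∫ ξ, W n (p.1 - ξ) p.2 ∂(μ j))
        (fun p => ∫ ξ, W n (p.1 - ξ) p.2 ∂ν) atTop K) :
    ∀ ψ : EuclideanSpace ℝ (Fin n) → ℝ, Continuous ψ → HasCompactSupport ψ →
      Tendsto (fun j => ∫ x, ψ x ∂(μ j)) atTop (nhds (∫ x, ψ x ∂ν)) := by
  intro ψ hψ hψc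
  -- pointwise convergence
  have hpt : ∀ (x : EuclideanSpace ℝ (Fin n)) (t : ℝ), 0 < t →
      Tendsto (fun j => ∫ ξ, W n (x - ξ) t ∂(μ j)) atTop (nhds (∫ ξ, W n (x - ξ) t ∂ν)) := by
    intro x t ht
    exact (hconv {(x, t)} isCompact_singleton (by simpa using ht)).tendsto_at
      (Set.mem_singleton _)
  -- the Gaussian weight
  set g : EuclideanSpace ℝ (Fin n) → ℝ := fun x => Real.exp (-1 * ‖x‖ ^ 2) with hg
  have hgc : Continuous g := by fun_prop
  have hgpos : ∀ x, 0 < g x := fun x => Real.exp_pos _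
  -- the property for the monoid
  have hmon : ∀ F ∈ gaussMonoid n, ∃ (C t : ℝ) (z : EuclideanSpace ℝ (Fin n)), 0 < t ∧
      (fun x : EuclideanSpace ℝ (Fin n) => F x * g x) = fun x => C * W n (z - x) t := by
    rintro F ⟨a, ha, b, c, hF⟩
    obtain ⟨C, t, z, ht, h⟩ := exp_eq_W (a + 1) (by linarith) b c
    refine ⟨C, t, z, ht, ?_⟩
    rw [← h]
    funext x
    rw [hF, hg, ← Real.exp_add]
    congr 1
    ring
  obtain ⟨C0, t0, z0, ht0, hg0⟩ := hmon 1 (one_mem _)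
  simp only [ContinuousMap.one_apply, one_mul] at hg0
  have hgμ : ∀ j, Integrable g (μ j) := fun j => by
    change Integrable (fun x => g x) (μ j)
    rw [hg0]; exact (hμ j z0 t0 ht0).const_mul C0
  have hgν : Integrable g ν := by
    change Integrable (fun x => g x) ν
    rw [hg0]; exact (hν z0 t0 ht0).const_mul C0
  have hglim : Tendsto (fun j => ∫ x, g x ∂(μ j)) atTop (nhds (∫ x, g x ∂ν)) := by
    rw [hg0]
    simp only [integral_const_mul]
    exact (hpt z0 t0 ht0).const_mul C0
  have hint : ∀ (m : Measure (EuclideanSpace ℝ (Fin n))), Integrable g m →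
      ∀ F : C(OnePoint (EuclideanSpace ℝ (Fin n)), ℝ), Integrable (fun x : EuclideanSpace ℝ (Fin n) => F x * g x) m := by
    intro m hm F
    refine hm.bdd_mul (c := ‖F‖) ?_ ?_
    · exact (F.continuous.comp OnePoint.continuous_coe).aestronglyMeasurable
    · exact Eventually.of_forall fun x => F.norm_coe_le_norm _
  have hdiff : ∀ (m : Measure (EuclideanSpace ℝ (Fin n))), Integrable g m →
      ∀ F H : C(OnePoint (EuclideanSpace ℝ (Fin n)), ℝ),
        |∫ x : EuclideanSpace ℝ (Fin n), F x * g x ∂m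
          - ∫ x : EuclideanSpace ℝ (Fin n), H x * g x ∂m| ≤ ‖F - H‖ * ∫ x, g x ∂m := by
    intro m hm F H
    rw [← integral_sub (hint m hm F) (hint m hm H), ← integral_const_mul, ← Real.norm_eq_abs]
    refine norm_integral_le_of_norm_le (hm.const_mul _) (Eventually.of_forall fun x => ?_)
    rw [← sub_mul, norm_mul, Real.norm_of_nonneg (hgpos x).le]
    exact mul_le_mul_of_nonneg_right ((F - H).norm_coe_le_norm _) (hgpos x).le
  have hspan : ∀ F ∈ Submodule.span ℝ
      (gaussMonoid n : Set C(OnePoint (EuclideanSpace ℝ (Fin n)), ℝ)),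
      Tendsto (fun j => ∫ x : EuclideanSpace ℝ (Fin n), F x * g x ∂(μ j)) atTop
        (nhds (∫ x : EuclideanSpace ℝ (Fin n), F x * g x ∂ν)) := by
    intro F hF
    induction hF using Submodule.span_induction with
    | mem F hF =>
      obtain ⟨C, t, z, ht, h⟩ := hmon F hF
      rw [h]
      simp only [integral_const_mul]
      exact (hpt z t ht).const_mul C
    | zero => simp
    | add F H _ _ h1 h2 =>
      have := h1.add h2
      rw [← integral_add (hint ν hgν F) (hint ν hgν H)] at this
      simp only [ContinuousMap.add_apply, add_mul]
      refine this.congr fun j => ?_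
      rw [← integral_add (hint _ (hgμ j) F) (hint _ (hgμ j) H)]
    | smul c F _ h =>
      simp only [ContinuousMap.smul_apply, smul_eq_mul, mul_assoc, integral_const_mul]
      exact h.const_mul c
  -- the test function
  have hφc : HasCompactSupport (fun x => ψ x * (g x)⁻¹) := hψc.mul_right
  set Φ : C(OnePoint (EuclideanSpace ℝ (Fin n)), ℝ) :=
    extZero (fun x => ψ x * (g x)⁻¹) (hψ.mul (hgc.inv₀ fun x => (hgpos x).ne'))
      hφc.is_zero_at_infty with hΦ
  have hΦg : ∀ x : EuclideanSpace ℝ (Fin n), ψ x = Φ x * g x := by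
    intro x
    change ψ x = ψ x * (g x)⁻¹ * g x
    rw [mul_assoc, inv_mul_cancel₀ (hgpos x).ne', mul_one]
  simp only [hΦg]
  set M : ℝ := (∫ x, g x ∂ν) + 1 with hM
  have hMpos : 0 < M := by
    have : 0 ≤ ∫ x, g x ∂ν := integral_nonneg fun x => (hgpos x).le
    linarith
  rw [Metric.tendsto_nhds]
  intro ε hε
  obtain ⟨H, hHs, hH⟩ := gauss_dense n Φ (ε / (3 * M)) (by positivity)
  have e1 := Metric.tendsto_nhds.1 (hspan H hHs) (ε / 3) (by positivity)
  have e2 : ∀ᶠ j in atTop, ∫ x, g x ∂(μ j) < M := hglim.eventually_lt_const (by linarith)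
  filter_upwards [e1, e2] with j h1 h2
  have bound : ∀ m : Measure (EuclideanSpace ℝ (Fin n)), Integrable g m →
      ∫ x, g x ∂m < M →
        |∫ x : EuclideanSpace ℝ (Fin n), H x * g x ∂m
          - ∫ x : EuclideanSpace ℝ (Fin n), Φ x * g x ∂m| ≤ ε / 3 := by
    intro m hm hlt
    refine (hdiff m hm H Φ).trans ?_
    calc ‖H - Φ‖ * ∫ x, g x ∂m ≤ ε / (3 * M) * M :=
          mul_le_mul hH.le hlt.le (integral_nonneg fun x => (hgpos x).le) (by positivity)
      _ = ε / 3 := by field_simp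
  have b1 := abs_le.1 (bound _ (hgμ j) h2)
  have b2 := abs_le.1 (bound ν hgν (by linarith))
  rw [Real.dist_eq, abs_lt] at h1 ⊢
  constructor <;> linarith [h1.1, h1.2, b1.1, b1.2, b2.1, b2.2]
end

section
/- Let μ be a finite nonnegative Borel measure on ℝ^n with heat extension u(x,t) = ∫ (4πt)^{-n/2} exp(-‖x−ξ‖²/(4t)) dμ(ξ). If for every α > 0, u(x,t) → L as (x,t) → (x₀,0) within the parabolic region {‖x−x₀‖² < α t}, then for every open ball B ⊂ ℝ^n, μ(x₀ + rB)/m(rB) → L as r → 0⁺ (i.e., the strong derivative Dμ(x₀) exists and equals L). -/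
open Pointwise MeasureTheory Filter

lemma W_nonneg' (n : ℕ) (x : EuclideanSpace ℝ (Fin n)) {t : ℝ} (ht : 0 < t) : 0 ≤ W n x t := by
  unfold W; positivity

lemma W_cont (n : ℕ) (t : ℝ) : Continuous (fun x => W n x t) := by
  unfold W; fun_prop

lemma W_le (n : ℕ) {t d : ℝ} (ht : 0 < t) (hd : 0 ≤ d) (x : EuclideanSpace ℝ (Fin n))
    (hx : d ≤ ‖x‖) :
    W n x t ≤ ((2 : ℝ) ^ ((n : ℝ) / 2) * Real.exp (-(d ^ 2 / (8 * t)))) * W n x (2 * t) := by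
  unfold W
  have h1 : (4 * Real.pi * (2 * t)) ^ (-(n : ℝ) / 2)
      = (2 : ℝ) ^ (-(n : ℝ) / 2) * (4 * Real.pi * t) ^ (-(n : ℝ) / 2) := by
    rw [← Real.mul_rpow (by positivity) (by positivity)]
    congr 1; ring
  have h2 : (2 : ℝ) ^ ((n : ℝ) / 2) * (2 : ℝ) ^ (-(n : ℝ) / 2) = 1 := by
    rw [← Real.rpow_add (by norm_num), neg_div, add_neg_cancel, Real.rpow_zero]
  have h3 : Real.exp (-‖x‖ ^ 2 / (4 * t))
      ≤ Real.exp (-(d ^ 2 / (8 * t))) * Real.exp (-‖x‖ ^ 2 / (4 * (2 * t))) := by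
    rw [← Real.exp_add]
    apply Real.exp_le_exp.mpr
    have h4 : d ^ 2 / (8 * t) ≤ ‖x‖ ^ 2 / (8 * t) := by gcongr
    have h5 : -‖x‖ ^ 2 / (4 * t) = -(‖x‖ ^ 2 / (8 * t)) + -‖x‖ ^ 2 / (4 * (2 * t)) := by
      field_simp; ring
    rw [h5]; linarith
  rw [h1]
  calc _ ≤ (4 * Real.pi * t) ^ (-(n : ℝ) / 2) *
        (Real.exp (-(d ^ 2 / (8 * t))) * Real.exp (-‖x‖ ^ 2 / (4 * (2 * t)))) := by gcongr
    _ = ((2 : ℝ) ^ ((n : ℝ) / 2) * (2 : ℝ) ^ (-(n : ℝ) / 2)) * ((4 * Real.pi * t) ^ (-(n : ℝ) / 2) *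
        (Real.exp (-(d ^ 2 / (8 * t))) * Real.exp (-‖x‖ ^ 2 / (4 * (2 * t))))) := by
          rw [h2, one_mul]
    _ = _ := by ring

lemma W_lint (n : ℕ) {t : ℝ} (ht : 0 < t) :
    ∫⁻ x : EuclideanSpace ℝ (Fin n), ENNReal.ofReal (W n x t) = 1 := by
  have hb : 0 < 1 / (4 * t) := by positivity
  have h1 := GaussianFourier.integral_rexp_neg_mul_sq_norm (V := EuclideanSpace ℝ (Fin n)) hb
  have h0 : (fun x => W n x t) = fun x => (4 * Real.pi * t) ^ (-(n : ℝ) / 2) *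
      Real.exp (-(1 / (4 * t)) * ‖x‖ ^ 2) := by
    ext x; unfold W; congr 2; ring
  have hp : (4 * Real.pi * t) ^ (-(n : ℝ) / 2) * (4 * Real.pi * t) ^ ((n : ℝ) / 2) = 1 := by
    rw [← Real.rpow_add (by positivity), neg_div, neg_add_cancel, Real.rpow_zero]
  have h2 : ∫ x, W n x t = 1 := by
    rw [h0, integral_const_mul, h1, finrank_euclideanSpace_fin]
    rw [show Real.pi / (1 / (4 * t)) = 4 * Real.pi * t by field_simp]
    exact hp
  have hi : Integrable (fun x => W n x t) := by
    by_contra h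
    rw [integral_undef h] at h2
    norm_num at h2
  rw [← ofReal_integral_eq_lintegral_ofReal hi (ae_of_all _ fun x => W_nonneg' n x ht), h2]
  simp

lemma W_meas2 (n : ℕ) (t : ℝ) : Measurable
    (fun p : EuclideanSpace ℝ (Fin n) × EuclideanSpace ℝ (Fin n) =>
      ENNReal.ofReal (W n (p.1 - p.2) t)) :=
  (ENNReal.continuous_ofReal.comp ((W_cont n t).comp (continuous_fst.sub continuous_snd))).measurable

lemma upperA {n : ℕ} (μ : Measure (EuclideanSpace ℝ (Fin n))) [IsFiniteMeasure μ]
    (c : EuclideanSpace ℝ (Fin n)) (ρ : ℝ) {d t : ℝ} (hd : 0 ≤ d) (ht : 0 < t) {η : ℝ}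
    (hη : (2 : ℝ) ^ ((n : ℝ) / 2) * Real.exp (-(d ^ 2 / (8 * t))) ≤ η) :
    μ (Metric.ball c ρ) ≤
      (∫⁻ x in Metric.ball c (ρ + d), ∫⁻ ξ, ENNReal.ofReal (W n (x - ξ) t) ∂μ)
        + ENNReal.ofReal η * μ (Metric.ball c ρ) := by
  have hη0 : 0 ≤ η := le_trans (by positivity) hη
  have hm := W_meas2 n t
  have key : ∀ ξ ∈ Metric.ball c ρ, (1 : ENNReal) ≤
      (∫⁻ x in Metric.ball c (ρ + d), ENNReal.ofReal (W n (x - ξ) t)) + ENNReal.ofReal η := by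
    intro ξ hξ
    rw [← W_lint n ht, ← lintegral_sub_right_eq_self _ ξ,
      ← lintegral_add_compl _ (Metric.isOpen_ball (x := c) (ε := ρ + d)).measurableSet]
    gcongr
    calc _ ≤ ∫⁻ x in (Metric.ball c (ρ + d))ᶜ, ENNReal.ofReal η * ENNReal.ofReal (W n (x - ξ) (2 * t)) := by
          refine setLIntegral_mono' Metric.isOpen_ball.measurableSet.compl fun x hx => ?_
          rw [← ENNReal.ofReal_mul hη0]
          apply ENNReal.ofReal_le_ofReal
          have hxd : d ≤ ‖x - ξ‖ := by
            rw [← dist_eq_norm]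
            simp only [Set.mem_compl_iff, Metric.mem_ball, not_lt] at hx hξ
            have := dist_triangle x ξ c
            linarith
          exact (W_le n ht hd _ hxd).trans
            (mul_le_mul_of_nonneg_right hη (W_nonneg' n _ (by positivity)))
      _ ≤ ∫⁻ x, ENNReal.ofReal η * ENNReal.ofReal (W n (x - ξ) (2 * t)) := setLIntegral_le_lintegral _ _
      _ = ENNReal.ofReal η := by
          rw [lintegral_const_mul' _ _ ENNReal.ofReal_ne_top,
            lintegral_sub_right_eq_self (fun x => ENNReal.ofReal (W n x (2 * t))) ξ,
            W_lint n (by positivity), mul_one]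
  calc μ (Metric.ball c ρ) = ∫⁻ ξ in Metric.ball c ρ, 1 ∂μ := by simp
    _ ≤ ∫⁻ ξ in Metric.ball c ρ, ((∫⁻ x in Metric.ball c (ρ + d), ENNReal.ofReal (W n (x - ξ) t))
          + ENNReal.ofReal η) ∂μ := setLIntegral_mono' Metric.isOpen_ball.measurableSet key
    _ = (∫⁻ ξ in Metric.ball c ρ, (∫⁻ x in Metric.ball c (ρ + d), ENNReal.ofReal (W n (x - ξ) t)) ∂μ)
          + ENNReal.ofReal η * μ (Metric.ball c ρ) := by
        rw [lintegral_add_right _ measurable_const]; simp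
    _ ≤ _ := by
        refine add_le_add ?_ le_rfl
        refine (setLIntegral_le_lintegral _ _).trans (le_of_eq ?_)
        rw [lintegral_lintegral_swap]
        exact (hm.comp measurable_swap).aemeasurable

lemma lowerB {n : ℕ} (μ : Measure (EuclideanSpace ℝ (Fin n))) [IsFiniteMeasure μ]
    (c : EuclideanSpace ℝ (Fin n)) (ρ : ℝ) {d t : ℝ} (hd : 0 ≤ d) (ht : 0 < t) {η : ℝ}
    (hη : (2 : ℝ) ^ ((n : ℝ) / 2) * Real.exp (-(d ^ 2 / (8 * t))) ≤ η) :
    (∫⁻ x in Metric.ball c (ρ - d), ∫⁻ ξ, ENNReal.ofReal (W n (x - ξ) t) ∂μ)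
      ≤ μ (Metric.ball c ρ) + ENNReal.ofReal η *
        ∫⁻ x in Metric.ball c (ρ - d), ∫⁻ ξ, ENNReal.ofReal (W n (x - ξ) (2 * t)) ∂μ := by
  have hη0 : 0 ≤ η := le_trans (by positivity) hη
  have hm := W_meas2 n t
  calc _ ≤ ∫⁻ x in Metric.ball c (ρ - d), ((∫⁻ ξ in Metric.ball c ρ, ENNReal.ofReal (W n (x - ξ) t) ∂μ)
        + ENNReal.ofReal η * ∫⁻ ξ, ENNReal.ofReal (W n (x - ξ) (2 * t)) ∂μ) := by
        refine setLIntegral_mono' Metric.isOpen_ball.measurableSet fun x hx => ?_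
        rw [← lintegral_add_compl _ (Metric.isOpen_ball (x := c) (ε := ρ)).measurableSet]
        gcongr
        rw [← lintegral_const_mul' _ _ ENNReal.ofReal_ne_top]
        refine le_trans ?_ (setLIntegral_le_lintegral (Metric.ball c ρ)ᶜ _)
        refine setLIntegral_mono' Metric.isOpen_ball.measurableSet.compl fun ξ hξ => ?_
        rw [← ENNReal.ofReal_mul hη0]
        apply ENNReal.ofReal_le_ofReal
        have hxd : d ≤ ‖x - ξ‖ := by
          rw [← dist_eq_norm, dist_comm]
          simp only [Set.mem_compl_iff, Metric.mem_ball, not_lt] at hx hξ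
          have := dist_triangle ξ x c
          linarith
        exact (W_le n ht hd _ hxd).trans
          (mul_le_mul_of_nonneg_right hη (W_nonneg' n _ (by positivity)))
    _ = (∫⁻ x in Metric.ball c (ρ - d), ∫⁻ ξ in Metric.ball c ρ, ENNReal.ofReal (W n (x - ξ) t) ∂μ)
        + ENNReal.ofReal η *
        ∫⁻ x in Metric.ball c (ρ - d), ∫⁻ ξ, ENNReal.ofReal (W n (x - ξ) (2 * t)) ∂μ := by
        rw [lintegral_add_left, lintegral_const_mul' _ _ ENNReal.ofReal_ne_top]
        exact hm.lintegral_prod_right'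
    _ ≤ _ := by
        gcongr
        rw [lintegral_lintegral_swap hm.aemeasurable]
        calc _ ≤ ∫⁻ ξ in Metric.ball c ρ, 1 ∂μ := by
              refine lintegral_mono fun ξ => ?_
              refine (setLIntegral_le_lintegral _ _).trans (le_of_eq ?_)
              rw [lintegral_sub_right_eq_self (fun x => ENNReal.ofReal (W n x t)) ξ, W_lint n ht]
          _ = _ := by simp

lemma U_eq {n : ℕ} (μ : Measure (EuclideanSpace ℝ (Fin n))) [IsFiniteMeasure μ]
    (x : EuclideanSpace ℝ (Fin n)) {t : ℝ} (ht : 0 < t) :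
    ∫⁻ ξ, ENNReal.ofReal (W n (x - ξ) t) ∂μ = ENNReal.ofReal (∫ ξ, W n (x - ξ) t ∂μ) := by
  rw [ofReal_integral_eq_lintegral_ofReal]
  · have hc : Continuous fun ξ => W n (x - ξ) t := (W_cont n t).comp (continuous_const.sub continuous_id)
    refine Integrable.of_bound hc.aestronglyMeasurable ((4 * Real.pi * t) ^ (-(n : ℝ) / 2))
      (ae_of_all _ fun ξ => ?_)
    rw [Real.norm_of_nonneg (W_nonneg' n _ ht)]
    unfold W
    refine mul_le_of_le_one_right (by positivity) (Real.exp_le_one_iff.mpr ?_)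
    have : 0 ≤ ‖x - ξ‖ ^ 2 / (4 * t) := by positivity
    rw [neg_div]; linarith
  · exact ae_of_all _ fun ξ => W_nonneg' n _ ht

lemma unif {n : ℕ} (μ : Measure (EuclideanSpace ℝ (Fin n)))
    (x₀ : EuclideanSpace ℝ (Fin n)) (L : ℝ)
    (hpar : ∀ α : ℝ, 0 < α →
      Tendsto (fun p : EuclideanSpace ℝ (Fin n) × ℝ => ∫ ξ, W n (p.1 - ξ) p.2 ∂μ)
        (nhdsWithin (x₀, 0) {p | ‖p.1 - x₀‖ ^ 2 < α * p.2}) (nhds L))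
    (y : EuclideanSpace ℝ (Fin n)) {R t κ : ℝ} (hR : 0 < R) (ht : 0 < t) (hκ : 0 < κ) :
    ∀ᶠ r in nhdsWithin (0 : ℝ) (Set.Ioi 0), ∀ x ∈ Metric.ball (x₀ + r • y) (r * R),
      |(∫ ξ, W n (x - ξ) (r ^ 2 * t) ∂μ) - L| < κ := by
  set M := ‖y‖ + R with hM
  have hM0 : 0 < M := by positivity
  have h := hpar (M ^ 2 / t) (by positivity)
  rw [Metric.tendsto_nhdsWithin_nhds] at h
  obtain ⟨δ, hδ, h⟩ := h κ hκ
  have e1 : ∀ᶠ r in nhdsWithin (0 : ℝ) (Set.Ioi 0), r * M < δ := by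
    have : Tendsto (fun r : ℝ => r * M) (nhds 0) (nhds (0 * M)) := by
      exact (continuous_id.mul continuous_const).tendsto _
    rw [zero_mul] at this
    exact (this.mono_left nhdsWithin_le_nhds).eventually (gt_mem_nhds hδ)
  have e2 : ∀ᶠ r in nhdsWithin (0 : ℝ) (Set.Ioi 0), r ^ 2 * t < δ := by
    have : Tendsto (fun r : ℝ => r ^ 2 * t) (nhds 0) (nhds (0 ^ 2 * t)) := by
      exact ((continuous_id.pow 2).mul continuous_const).tendsto _
    rw [zero_pow two_ne_zero, zero_mul] at this
    exact (this.mono_left nhdsWithin_le_nhds).eventually (gt_mem_nhds hδ)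
  filter_upwards [e1, e2, self_mem_nhdsWithin] with r h1 h2 hr x hx
  have hr : 0 < r := hr
  have hn : ‖x - x₀‖ < r * M := by
    rw [Metric.mem_ball, dist_eq_norm] at hx
    have : x - x₀ = (x - (x₀ + r • y)) + r • y := by abel
    rw [this]
    refine (norm_add_le _ _).trans_lt ?_
    rw [norm_smul, Real.norm_of_nonneg hr.le, hM]
    linarith
  have := @h (x, r ^ 2 * t) (by
    simp only [Set.mem_ofPred_eq]
    calc ‖x - x₀‖ ^ 2 < (r * M) ^ 2 := by gcongr
      _ = _ := by field_simp) (by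
    rw [Prod.dist_eq, max_lt_iff]
    refine ⟨by rw [dist_eq_norm]; exact hn.trans h1, ?_⟩
    rw [Real.dist_eq, sub_zero, abs_of_pos (by positivity)]
    exact h2)
  rwa [Real.dist_eq] at this

lemma vol_ball' {n : ℕ} (c : EuclideanSpace ℝ (Fin n)) {ρ : ℝ} (hρ : 0 < ρ) :
    volume (Metric.ball c ρ) = ENNReal.ofReal
      (ρ ^ n * (volume (Metric.ball (0 : EuclideanSpace ℝ (Fin n)) 1)).toReal) := by
  rw [Measure.addHaar_ball_of_pos _ _ hρ, finrank_euclideanSpace_fin,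
    ENNReal.ofReal_mul (by positivity), ENNReal.ofReal_toReal measure_ball_lt_top.ne]

lemma exists_t (n : ℕ) {d κ : ℝ} (hd : 0 < d) (hκ : 0 < κ) : ∃ t : ℝ, 0 < t ∧
    (2 : ℝ) ^ ((n : ℝ) / 2) * Real.exp (-(d ^ 2 / (8 * t))) ≤ κ := by
  have h : Tendsto (fun a : ℝ => (2 : ℝ) ^ ((n : ℝ) / 2) * Real.exp (-a)) atTop (nhds 0) := by
    have := (Real.tendsto_exp_neg_atTop_nhds_zero).const_mul ((2 : ℝ) ^ ((n : ℝ) / 2))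
    rwa [mul_zero] at this
  obtain ⟨a, ha, ha0⟩ := ((h.eventually (gt_mem_nhds hκ)).and (eventually_gt_atTop 0)).exists
  refine ⟨d ^ 2 / (8 * a), by positivity, ?_⟩
  have : d ^ 2 / (8 * (d ^ 2 / (8 * a))) = a := by field_simp
  rw [this]; exact ha.le

lemma bounds {n : ℕ} (μ : Measure (EuclideanSpace ℝ (Fin n))) [IsFiniteMeasure μ]
    (x₀ : EuclideanSpace ℝ (Fin n)) (L : ℝ) (hL : 0 ≤ L)
    (hpar : ∀ α : ℝ, 0 < α →
      Tendsto (fun p : EuclideanSpace ℝ (Fin n) × ℝ => ∫ ξ, W n (p.1 - ξ) p.2 ∂μ)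
        (nhdsWithin (x₀, 0) {p | ‖p.1 - x₀‖ ^ 2 < α * p.2}) (nhds L))
    (y : EuclideanSpace ℝ (Fin n)) {s κ : ℝ} (hs : 0 < s) (hκ : 0 < κ) (hκ1 : κ < 1) :
    ∀ᶠ r in nhdsWithin (0 : ℝ) (Set.Ioi 0),
      (μ (Metric.ball (x₀ + r • y) (r * s))).toReal
        / (volume (Metric.ball (r • y) (r * s))).toReal ≤ (L + κ) * (1 + κ) ^ n / (1 - κ) ∧
      (L - κ) * (1 - κ) ^ n - κ * ((L + κ) * (1 - κ) ^ n) ≤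
      (μ (Metric.ball (x₀ + r • y) (r * s))).toReal
        / (volume (Metric.ball (r • y) (r * s))).toReal := by
  obtain ⟨t, ht, hη⟩ := exists_t n (d := κ * s) (by positivity) hκ
  have hk : 0 < 1 - κ := by linarith
  filter_upwards [unif μ x₀ L hpar y (R := s + κ * s) (by positivity) ht hκ,
    unif μ x₀ L hpar y (R := s - κ * s) (by nlinarith) ht hκ,
    unif μ x₀ L hpar y (R := s - κ * s) (t := 2 * t) (by nlinarith) (by positivity) hκ,
    self_mem_nhdsWithin] with r h1 h2 h3 hr
  have hr : 0 < r := hr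
  have hη' : (2 : ℝ) ^ ((n : ℝ) / 2) * Real.exp (-((r * (κ * s)) ^ 2 / (8 * (r ^ 2 * t)))) ≤ κ := by
    convert hη using 4
    field_simp
  set c := x₀ + r • y
  set v := (volume (Metric.ball (0 : EuclideanSpace ℝ (Fin n)) 1)).toReal with hv
  have hv0 : 0 < v := ENNReal.toReal_pos (Metric.measure_ball_pos _ _ one_pos).ne' measure_ball_lt_top.ne
  set m := (μ (Metric.ball c (r * s))).toReal with hm
  have hμ : μ (Metric.ball c (r * s)) = ENNReal.ofReal m :=
    (ENNReal.ofReal_toReal (measure_ne_top _ _)).symm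
  have hm0 : 0 ≤ m := ENNReal.toReal_nonneg
  have hrs : 0 < r * s := by positivity
  rw [vol_ball' _ hrs, ENNReal.toReal_ofReal (by positivity)]
  have hD : 0 < (r * s) ^ n * v := by positivity
  have ht2 : 0 < r ^ 2 * t := by positivity
  have A := upperA μ c (r * s) (d := r * (κ * s)) (t := r ^ 2 * t) (by positivity) ht2 hη'
  have B := lowerB μ c (r * s) (d := r * (κ * s)) (t := r ^ 2 * t) (by positivity) ht2 hη'
  rw [show r * s + r * (κ * s) = r * (s + κ * s) by ring] at A
  rw [show r * s - r * (κ * s) = r * (s - κ * s) by ring] at B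
  have hp : 0 < r * (s + κ * s) := by positivity
  have hq : 0 < r * (s - κ * s) := mul_pos hr (by nlinarith)
  have up : ∀ (ρ τ : ℝ), 0 < ρ → 0 < τ →
      (∀ x ∈ Metric.ball c ρ, |(∫ ξ, W n (x - ξ) τ ∂μ) - L| < κ) →
      (∫⁻ x in Metric.ball c ρ, ∫⁻ ξ, ENNReal.ofReal (W n (x - ξ) τ) ∂μ)
        ≤ ENNReal.ofReal ((L + κ) * (ρ ^ n * v)) := by
    intro ρ τ hρ hτ h
    rw [ENNReal.ofReal_mul (by positivity), ← vol_ball' c hρ, ← setLIntegral_const]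
    refine setLIntegral_mono' Metric.isOpen_ball.measurableSet fun x hx => ?_
    rw [U_eq μ x hτ]
    exact ENNReal.ofReal_le_ofReal (by linarith [(abs_lt.mp (h x hx)).2])
  have lo : ∀ (ρ τ : ℝ), 0 < ρ → 0 < τ →
      (∀ x ∈ Metric.ball c ρ, |(∫ ξ, W n (x - ξ) τ ∂μ) - L| < κ) →
      ENNReal.ofReal ((L - κ) * (ρ ^ n * v)) ≤
      (∫⁻ x in Metric.ball c ρ, ∫⁻ ξ, ENNReal.ofReal (W n (x - ξ) τ) ∂μ) := by
    intro ρ τ hρ hτ h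
    rw [ENNReal.ofReal_mul' (by positivity), ← vol_ball' c hρ, ← setLIntegral_const]
    refine setLIntegral_mono' Metric.isOpen_ball.measurableSet fun x hx => ?_
    rw [U_eq μ x hτ]
    exact ENNReal.ofReal_le_ofReal (by linarith [(abs_lt.mp (h x hx)).1])
  have hpn : (r * (s + κ * s)) ^ n = (1 + κ) ^ n * (r * s) ^ n := by
    rw [← mul_pow]; congr 1; ring
  have hqn : (r * (s - κ * s)) ^ n = (1 - κ) ^ n * (r * s) ^ n := by
    rw [← mul_pow]; congr 1; ring
  constructor
  · have A' := A.trans (add_le_add_left (up _ _ hp ht2 h1) _)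
    rw [hμ, ← ENNReal.ofReal_mul hκ.le, ← ENNReal.ofReal_add (by positivity) (by positivity),
      ENNReal.ofReal_le_ofReal_iff (by positivity), hpn] at A'
    rw [div_le_div_iff₀ hD hk]
    linarith
  · have B' := (lo _ _ hq ht2 h2).trans (B.trans (add_le_add_right (mul_le_mul_right (up _ (2 * (r ^ 2 * t)) hq (by positivity)
      (by rw [show 2 * (r ^ 2 * t) = r ^ 2 * (2 * t) by ring]; exact h3)) _) _))
    rw [hμ, ← ENNReal.ofReal_mul hκ.le, ← ENNReal.ofReal_add (by positivity) (by positivity),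
      ENNReal.ofReal_le_ofReal_iff (by positivity), hqn] at B'
    rw [le_div_iff₀ hD]
    linarith

theorem stmt16 {n : ℕ} (μ : Measure (EuclideanSpace ℝ (Fin n))) [IsFiniteMeasure μ]
    (x₀ : EuclideanSpace ℝ (Fin n)) (L : ℝ) (hL : 0 ≤ L)
    (hpar : ∀ α : ℝ, 0 < α →
      Tendsto (fun p : EuclideanSpace ℝ (Fin n) × ℝ => ∫ ξ, W n (p.1 - ξ) p.2 ∂μ)
        (nhdsWithin (x₀, 0) {p | ‖p.1 - x₀‖ ^ 2 < α * p.2}) (nhds L)) :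
    ∀ (y : EuclideanSpace ℝ (Fin n)) (s : ℝ), 0 < s →
      Tendsto (fun r : ℝ =>
          (μ ((fun z => x₀ + r • z) '' Metric.ball y s)).toReal
            / (volume ((r : ℝ) • Metric.ball y s)).toReal)
        (nhdsWithin 0 (Set.Ioi 0)) (nhds L) := by
  intro y s hs
  have heq : ∀ᶠ r in nhdsWithin (0 : ℝ) (Set.Ioi 0),
      (μ (Metric.ball (x₀ + r • y) (r * s))).toReal
        / (volume (Metric.ball (r • y) (r * s))).toReal =
      (μ ((fun z => x₀ + r • z) '' Metric.ball y s)).toReal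
            / (volume ((r : ℝ) • Metric.ball y s)).toReal := by
    filter_upwards [self_mem_nhdsWithin] with r hr
    have hr : 0 < r := hr
    have e1 : r • Metric.ball y s = Metric.ball (r • y) (r * s) := by
      rw [smul_ball hr.ne', Real.norm_of_nonneg hr.le]
    have e2 : (fun z => x₀ + r • z) '' Metric.ball y s = Metric.ball (x₀ + r • y) (r * s) := by
      have e3 : (fun z => x₀ + r • z) '' Metric.ball y s
          = (fun z => x₀ + z) '' (r • Metric.ball y s) := by
        rw [← Set.image_smul, Set.image_image]
      rw [e3, e1]
      simp [add_comm]
    rw [e1, e2]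
  refine Tendsto.congr' heq ?_
  have hU : Tendsto (fun κ : ℝ => (L + κ) * (1 + κ) ^ n / (1 - κ)) (nhdsWithin 0 (Set.Ioi 0))
      (nhds L) := by
    have : ContinuousAt (fun κ : ℝ => (L + κ) * (1 + κ) ^ n / (1 - κ)) 0 := by
      apply ContinuousAt.div
      · fun_prop
      · fun_prop
      · norm_num
    have h := this.tendsto
    simp only [add_zero, one_pow, mul_one, sub_zero, div_one] at h
    exact h.mono_left nhdsWithin_le_nhds
  have hW : Tendsto (fun κ : ℝ => (L - κ) * (1 - κ) ^ n - κ * ((L + κ) * (1 - κ) ^ n))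
      (nhdsWithin 0 (Set.Ioi 0)) (nhds L) := by
    have : Continuous (fun κ : ℝ => (L - κ) * (1 - κ) ^ n - κ * ((L + κ) * (1 - κ) ^ n)) := by
      fun_prop
    have h := this.tendsto 0
    simp only [add_zero, one_pow, mul_one, sub_zero, zero_mul] at h
    exact h.mono_left nhdsWithin_le_nhds
  have h01 : ∀ᶠ κ in nhdsWithin (0 : ℝ) (Set.Ioi 0), κ < 1 :=
    (gt_mem_nhds one_pos).filter_mono nhdsWithin_le_nhds
  rw [tendsto_order]
  constructor
  · intro a ha
    obtain ⟨κ, ⟨h1, h2⟩, h3⟩ := (((hW.eventually (lt_mem_nhds ha)).and h01).and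
      self_mem_nhdsWithin).exists
    filter_upwards [bounds μ x₀ L hL hpar y hs h3 h2] with r hr
    exact h1.trans_le hr.2
  · intro a ha
    obtain ⟨κ, ⟨h1, h2⟩, h3⟩ := (((hU.eventually (gt_mem_nhds ha)).and h01).and
      self_mem_nhdsWithin).exists
    filter_upwards [bounds μ x₀ L hL hpar y hs h3 h2] with r hr
    exact hr.1.trans_lt h1
end
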